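/- arXiv:2310.04102 — 10 statements merged into one kernel-verified Lean document; each statement's English description precedes it below -/
import Mathlib

section
/- Suppose there are 3 agents at locations x1 ≤ x2 ≤ x3 in [0,1]. Let c = 1 − x2² + x1·x2 + x2·x3 − x1·x3, α = x1 + x2 + x3 and β = 1 − x1·x2 − x2·x3 − x1·x3. If 2x1 − 2x2 + c ≥ 0 and 2x2 − 2x3 + c ≥ 0, then the unique Nash optimum for (x1,x2,x3) is x2. If 2x1 − 2x2 + c ≥ 0 and 2x2 − 2x3 + c < 0, then the unique Nash optimum is ((1+α) − √((1+α)² − 3(2x3 − β)))/3. If 2x1 − 2x2 + c < 0 and 2x2 − 2x3 + c ≥ 0, then the unique Nash optimum is ((−1+α) + √((−1+α)² + 3(2x1 + β)))/3. -/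
open Set

noncomputable section

/-- Utility of an agent at location `z` when the facility is at `y`. -/
def util (y z : ℝ) : ℝ := 1 - |y - z|

/-- Nash welfare: product of agents' utilities. -/
def nash {n : ℕ} (y : ℝ) (x : Fin n → ℝ) : ℝ := ∏ i, util y (x i)

/-- `y` is a Nash optimum for the profile `x`. -/
def isNashOpt {n : ℕ} (x : Fin n → ℝ) (y : ℝ) : Prop :=
  y ∈ Set.Icc (0 : ℝ) 1 ∧ ∀ z ∈ Set.Icc (0 : ℝ) 1, nash z x ≤ nash y x

theorem nash_three (y x₁ x₂ x₃ : ℝ) :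
    nash y ![x₁, x₂, x₃] = (1 - |y - x₁|) * (1 - |y - x₂|) * (1 - |y - x₃|) := by
  simp [nash, util, Fin.prod_univ_three]

theorem nash_three_reflect (y x₁ x₂ x₃ : ℝ) :
    nash (1 - y) ![1 - x₃, 1 - x₂, 1 - x₁] = nash y ![x₁, x₂, x₃] := by
  simp only [nash_three, sub_sub_sub_cancel_left, abs_sub_comm _ y]
  ring

theorem isNashOpt_iff_eq_of_forall_lt {n : ℕ} {x : Fin n → ℝ} {r : ℝ}
    (hr : r ∈ Set.Icc (0 : ℝ) 1)
    (h : ∀ z ∈ Set.Icc (0 : ℝ) 1, z ≠ r → nash z x < nash r x) (y : ℝ) :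
    isNashOpt x y ↔ y = r := by
  constructor
  · rintro ⟨hy, hmax⟩
    by_contra hne
    exact absurd (hmax r hr) (not_le.mpr (h y hy hne))
  · rintro rfl
    refine ⟨hr, fun z hz => ?_⟩
    by_cases hzy : z = y
    · rw [hzy]
    · exact (h z hz hzy).le

theorem isNashOpt_three_reflect (y x₁ x₂ x₃ : ℝ) :
    isNashOpt ![x₁, x₂, x₃] y ↔ isNashOpt ![1 - x₃, 1 - x₂, 1 - x₁] (1 - y) := by
  unfold isNashOpt
  rw [nash_three_reflect]
  refine and_congr ⟨fun h => ⟨by linarith [h.2], by linarith [h.1]⟩,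
    fun h => ⟨by linarith [h.2], by linarith [h.1]⟩⟩
    ⟨fun h z hz => ?_, fun h z hz => ?_⟩
  · have := h (1 - z) ⟨by linarith [hz.2], by linarith [hz.1]⟩
    rwa [← nash_three_reflect, sub_sub_cancel] at this
  · have := h (1 - z) ⟨by linarith [hz.2], by linarith [hz.1]⟩
    rwa [nash_three_reflect] at this

/-- The Nash welfare is dominated by the cubic it coincides with on `[x₂, x₃]`. -/
theorem nash_three_le_cubic {x₁ x₂ x₃ y : ℝ} (h0 : 0 ≤ x₁) (h12 : x₁ ≤ x₂) (h23 : x₂ ≤ x₃)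
    (h31 : x₃ ≤ 1) (hy : y ∈ Set.Icc (0 : ℝ) 1) :
    nash y ![x₁, x₂, x₃] ≤ (1 - y + x₁) * (1 - y + x₂) * (1 - x₃ + y) := by
  obtain ⟨hy0, hy1⟩ := hy
  have nonneg : ∀ x, 0 ≤ x → x ≤ 1 → 0 ≤ 1 - |y - x| := fun x hx hx' => by
    rw [sub_nonneg, abs_le]
    constructor <;> linarith
  rw [nash_three]
  have h₁ := nonneg x₁ h0 (by linarith)
  have h₂ := nonneg x₂ (by linarith) (by linarith)
  have h₃ := nonneg x₃ (by linarith) h31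
  have b₁ : 1 - |y - x₁| ≤ 1 - y + x₁ := by linarith [le_abs_self (y - x₁)]
  have b₂ : 1 - |y - x₂| ≤ 1 - y + x₂ := by linarith [le_abs_self (y - x₂)]
  have b₃ : 1 - |y - x₃| ≤ 1 - x₃ + y := by linarith [neg_abs_le (y - x₃)]
  have := h₁.trans b₁
  have := h₂.trans b₂
  gcongr

theorem nash_three_eq_cubic {x₁ x₂ x₃ y : ℝ} (h12 : x₁ ≤ x₂) (h2 : x₂ ≤ y) (h3 : y ≤ x₃) :
    nash y ![x₁, x₂, x₃] = (1 - y + x₁) * (1 - y + x₂) * (1 - x₃ + y) := by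
  rw [nash_three, abs_of_nonneg (by linarith : 0 ≤ y - x₁), abs_of_nonneg (sub_nonneg.mpr h2),
    abs_of_nonpos (sub_nonpos.mpr h3)]
  ring

theorem nash_three_lt_median_of_gt {x₁ x₂ x₃ y : ℝ} (h0 : 0 ≤ x₁) (h12 : x₁ ≤ x₂)
    (h23 : x₂ ≤ x₃) (h31 : x₃ ≤ 1)
    (h : 0 ≤ 2 * x₂ - 2 * x₃ + (1 - x₂ ^ 2 + x₁ * x₂ + x₂ * x₃ - x₁ * x₃))
    (hy : x₂ < y) (hy1 : y ≤ 1) :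
    nash y ![x₁, x₂, x₃] < nash x₂ ![x₁, x₂, x₃] := by
  refine (nash_three_le_cubic h0 h12 h23 h31 ⟨by linarith, hy1⟩).trans_lt ?_
  rw [nash_three_eq_cubic h12 le_rfl h23]
  set d := 2 * x₂ - 2 * x₃ + (1 - x₂ ^ 2 + x₁ * x₂ + x₂ * x₃ - x₁ * x₃) with hd
  have taylor : (1 - x₂ + x₁) * (1 - x₂ + x₂) * (1 - x₃ + x₂)
      - (1 - y + x₁) * (1 - y + x₂) * (1 - x₃ + y)
      = (y - x₂) * (d + (y - x₂) * (1 + x₁ + x₃ - y - x₂)) := by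
    rw [hd]; ring
  have hq : 0 ≤ 1 + x₁ + x₃ - y - x₂ := by linarith
  have hpos : 0 < d + (y - x₂) * (1 + x₁ + x₃ - y - x₂) := by
    rcases hq.eq_or_lt with hq | hq
    · have e₁ : x₁ = 0 := by linarith
      have e₃ : x₃ = x₂ := by linarith
      have : d = 1 := by rw [hd, e₁, e₃]; ring
      rw [← hq, this]; norm_num
    · have := mul_pos (sub_pos.mpr hy) hq
      linarith
  have := mul_pos (sub_pos.mpr hy) hpos
  linarith

theorem nash_three_lt_of_critical {x₁ x₂ x₃ r y : ℝ} (h0 : 0 ≤ x₁) (h12 : x₁ ≤ x₂)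
    (h31 : x₃ ≤ 1) (h2r : x₂ ≤ r) (hr3 : r ≤ x₃)
    (hcrit : (1 - r + x₁) * (1 - r + x₂) = (1 - x₃ + r) * ((1 - r + x₁) + (1 - r + x₂)))
    (hr : 3 * r < 1 + (x₁ + x₂ + x₃)) (hy : y ∈ Set.Icc (0 : ℝ) 1) (hne : y ≠ r) :
    nash y ![x₁, x₂, x₃] < nash r ![x₁, x₂, x₃] := by
  refine (nash_three_le_cubic h0 h12 (h2r.trans hr3) h31 hy).trans_lt ?_
  rw [nash_three_eq_cubic h12 h2r hr3]
  have taylor : (1 - r + x₁) * (1 - r + x₂) * (1 - x₃ + r)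
      - (1 - y + x₁) * (1 - y + x₂) * (1 - x₃ + y)
      = (y - r) ^ 2 * (1 + x₁ + x₂ + x₃ - 2 * r - y) := by
    linear_combination (r - y) * hcrit
  have hA : 0 < 1 - r + x₁ := by
    refine lt_of_le_of_ne (by linarith) fun hA => ?_
    rw [← hA, zero_mul, zero_add, eq_comm, mul_eq_zero] at hcrit
    rcases hcrit with h | h <;> linarith
  have hgap : 0 < 1 + x₁ + x₂ + x₃ - 2 * r - y := by
    have hsum : 0 < (1 - r + x₁) + (1 - r + x₂) := by linarith
    have hlt : 1 - x₃ + r < 1 - r + x₁ := by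
      by_contra hle
      push Not at hle
      nlinarith [mul_le_mul_of_nonneg_right hle hsum.le, mul_pos hA hA]
    linarith [hy.2]
  have := mul_pos (pow_pos (abs_pos.mpr (sub_ne_zero.mpr hne)) 2) hgap
  rw [sq_abs] at this
  linarith

theorem isNashOpt_three_iff_of_right {x₁ x₂ x₃ : ℝ} (h0 : 0 ≤ x₁) (h12 : x₁ ≤ x₂)
    (h23 : x₂ ≤ x₃) (h31 : x₃ ≤ 1)
    (h : 2 * x₂ - 2 * x₃ + (1 - x₂ ^ 2 + x₁ * x₂ + x₂ * x₃ - x₁ * x₃) < 0) (y : ℝ) :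
    isNashOpt ![x₁, x₂, x₃] y ↔
      y = ((1 + (x₁ + x₂ + x₃)) - Real.sqrt ((1 + (x₁ + x₂ + x₃)) ^ 2
        - 3 * (2 * x₃ - (1 - x₁ * x₂ - x₂ * x₃ - x₁ * x₃)))) / 3 := by
  set S := 1 + (x₁ + x₂ + x₃) with hS
  set D := S ^ 2 - 3 * (2 * x₃ - (1 - x₁ * x₂ - x₂ * x₃ - x₁ * x₃)) with hD
  have hx₂ : D < (S - 3 * x₂) ^ 2 := by rw [hD, hS]; nlinarith
  have hD₃ : D - (S - 3 * x₃) ^ 2 = 3 * ((1 - x₃ + x₁) * (x₃ - x₂) + (1 - x₃ + x₂)) := by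
    rw [hD, hS]; ring
  have hprod : 0 ≤ (1 - x₃ + x₁) * (x₃ - x₂) :=
    mul_nonneg (by linarith) (by linarith)
  have hx₃ : (S - 3 * x₃) ^ 2 ≤ D := by linarith
  have hDpos : 0 < D := by
    by_contra hle
    have hu : 1 - x₃ + x₂ = 0 := by linarith [sq_nonneg (S - 3 * x₃)]
    have : (S - 3 * x₃) ^ 2 = 0 := le_antisymm (by linarith) (sq_nonneg _)
    have := pow_eq_zero_iff (two_ne_zero) |>.mp this
    linarith
  have hs := Real.sq_sqrt hDpos.le
  have hspos := Real.sqrt_pos.mpr hDpos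
  have h2r : Real.sqrt D ≤ S - 3 * x₂ :=
    Real.sqrt_le_iff.mpr ⟨by linarith, hx₂.le⟩
  have hr3 : S - 3 * x₃ ≤ Real.sqrt D := Real.le_sqrt_of_sq_le hx₃
  set r := (S - Real.sqrt D) / 3 with hr
  have hrs : Real.sqrt D = S - 3 * r := by rw [hr]; ring
  rw [hrs] at hs hspos h2r hr3
  refine isNashOpt_iff_eq_of_forall_lt ⟨by linarith, by linarith⟩ (fun z hz hne => ?_) y
  refine nash_three_lt_of_critical h0 h12 h31 (by linarith) (by linarith) ?_ (by linarith) hz hne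
  rw [hD, hS] at hs
  linear_combination hs / 3

theorem nashFL_three_agents (x₁ x₂ x₃ : ℝ)
    (h0 : 0 ≤ x₁) (h12 : x₁ ≤ x₂) (h23 : x₂ ≤ x₃) (h31 : x₃ ≤ 1)
    (c α β : ℝ)
    (hc : c = 1 - x₂ ^ 2 + x₁ * x₂ + x₂ * x₃ - x₁ * x₃)
    (hα : α = x₁ + x₂ + x₃)
    (hβ : β = 1 - x₁ * x₂ - x₂ * x₃ - x₁ * x₃) :
    (2 * x₁ - 2 * x₂ + c ≥ 0 → 2 * x₂ - 2 * x₃ + c ≥ 0 →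
      ∀ y, isNashOpt ![x₁, x₂, x₃] y ↔ y = x₂) ∧
    (2 * x₁ - 2 * x₂ + c ≥ 0 → 2 * x₂ - 2 * x₃ + c < 0 →
      ∀ y, isNashOpt ![x₁, x₂, x₃] y ↔
        y = ((1 + α) - Real.sqrt ((1 + α) ^ 2 - 3 * (2 * x₃ - β))) / 3) ∧
    (2 * x₁ - 2 * x₂ + c < 0 → 2 * x₂ - 2 * x₃ + c ≥ 0 →
      ∀ y, isNashOpt ![x₁, x₂, x₃] y ↔
        y = ((-1 + α) + Real.sqrt ((-1 + α) ^ 2 + 3 * (2 * x₁ + β))) / 3) := by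
  subst hc hα hβ
  refine ⟨fun hl hr => ?_, fun _ hr => isNashOpt_three_iff_of_right h0 h12 h23 h31 hr,
    fun hl _ y => ?_⟩
  · refine isNashOpt_iff_eq_of_forall_lt ⟨by linarith, by linarith⟩ fun z hz hne => ?_
    rcases hne.lt_or_gt with hlt | hgt
    · rw [← nash_three_reflect z, ← nash_three_reflect x₂]
      exact nash_three_lt_median_of_gt (by linarith) (by linarith) (by linarith) (by linarith)
        (by linarith) (by linarith) (by linarith [hz.1])
    · exact nash_three_lt_median_of_gt h0 h12 h23 h31 hr hgt hz.2
  · rw [isNashOpt_three_reflect, isNashOpt_three_iff_of_right (by linarith) (by linarith)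
      (by linarith) (by linarith) (by linarith)]
    have hdisc : (1 + ((1 - x₃) + (1 - x₂) + (1 - x₁))) ^ 2 - 3 * (2 * (1 - x₁)
          - (1 - (1 - x₃) * (1 - x₂) - (1 - x₂) * (1 - x₁) - (1 - x₃) * (1 - x₁)))
        = (-1 + (x₁ + x₂ + x₃)) ^ 2
          + 3 * (2 * x₁ + (1 - x₁ * x₂ - x₂ * x₃ - x₁ * x₃)) := by ring
    rw [hdisc]
    constructor <;> intro h <;> linarith
end
end

section
/- There exists a profile of rational agent locations in [0,1] such that the Nash optimum is irrational. Concretely, for 3 agents at locations x1 = 1/7, x2 = 2/7 and x3 = 6/7, the point y* = (16 − √91)/21 satisfies Nash(y*, x) ≥ Nash(y, x) for all y ∈ [0,1], and (16 − √91)/21 is irrational. -/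
open Set

noncomputable section

theorem util_nonneg {y z : ℝ} (hy : y ∈ Icc (0 : ℝ) 1) (hz : z ∈ Icc (0 : ℝ) 1) :
    0 ≤ util y z := by
  obtain ⟨hy0, hy1⟩ := hy
  obtain ⟨hz0, hz1⟩ := hz
  have : |y - z| ≤ 1 := abs_le.2 ⟨by linarith, by linarith⟩
  unfold util
  linarith

theorem util_le_one_sub_sub (y z : ℝ) : util y z ≤ 1 - (y - z) :=
  sub_le_sub_left (le_abs_self _) _

theorem util_le_one_add_sub (y z : ℝ) : util y z ≤ 1 + (y - z) := by
  have := neg_le_abs (y - z)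
  unfold util
  linarith

theorem irrational_sqrt_ninety_one : Irrational √91 := by
  have h : ¬ IsSquare (91 : ℕ) := by
    rintro ⟨k, hk⟩
    have : k < 10 := by nlinarith
    interval_cases k <;> omega
  exact_mod_cast irrational_sqrt_natCast_iff.2 h

theorem nashFL_irrational :
    isNashOpt ![(1 : ℝ) / 7, 2 / 7, 6 / 7] ((16 - Real.sqrt 91) / 21) ∧
    Irrational ((16 - Real.sqrt 91) / 21) := by
  constructor
  · have hs : √91 ^ 2 = 91 := Real.sq_sqrt (by norm_num)
    have hs9 : 9 ≤ √91 := Real.le_sqrt_of_sq_le (by norm_num)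
    have hs10 : √91 ≤ 10 := Real.sqrt_le_iff.2 (by norm_num)
    set s := √91
    refine ⟨⟨by linarith, by linarith⟩, fun z hz ↦ ?_⟩
    have h₁ := util_nonneg hz (z := 1 / 7) (by norm_num)
    have h₂ := util_nonneg hz (z := 2 / 7) (by norm_num)
    have h₃ := util_nonneg hz (z := 6 / 7) (by norm_num)
    have hz_le : nash z ![(1 : ℝ) / 7, 2 / 7, 6 / 7] ≤
        (1 - (z - 1 / 7)) * (1 - (z - 2 / 7)) * (1 + (z - 6 / 7)) := by
      simp only [nash, Fin.prod_univ_three]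
      have e₁ := util_le_one_sub_sub z (1 / 7)
      have e₂ := util_le_one_sub_sub z (2 / 7)
      exact mul_le_mul (mul_le_mul e₁ e₂ h₂ (h₁.trans e₁)) (util_le_one_add_sub z (6 / 7)) h₃
        (mul_nonneg (h₁.trans e₁) (h₂.trans e₂))
    have hc : nash ((16 - s) / 21) ![(1 : ℝ) / 7, 2 / 7, 6 / 7] =
        (1 - ((16 - s) / 21 - 1 / 7)) * (1 - ((16 - s) / 21 - 2 / 7)) *
          (1 + ((16 - s) / 21 - 6 / 7)) := by
      simp only [nash, Fin.prod_univ_three, util, Matrix.cons_val]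
      rw [abs_of_nonneg (by linarith : (0 : ℝ) ≤ (16 - s) / 21 - 1 / 7),
        abs_of_nonneg (by linarith : (0 : ℝ) ≤ (16 - s) / 21 - 2 / 7),
        abs_of_nonpos (by linarith : (16 - s) / 21 - 6 / 7 ≤ 0), sub_neg_eq_add]
    rw [hc]
    refine hz_le.trans (sub_nonneg.1 ?_)
    have key : 0 ≤ (z - (16 - s) / 21) ^ 2 * ((16 + 2 * s) / 21 - z) :=
      mul_nonneg (sq_nonneg _) (by linarith [hz.2])
    refine key.trans_eq ?_
    have e : (16 + 2 * s) / 21 = 16 / 7 - 2 * ((16 - s) / 21) := by ring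
    rw [e]
    have hq : 3 * ((16 - s) / 21) ^ 2 - 32 / 7 * ((16 - s) / 21) + 55 / 49 = 0 := by
      linear_combination hs / 147
    linear_combination (z - (16 - s) / 21) * hq
  · exact_mod_cast (irrational_sqrt_ninety_one.natCast_sub 16).div_natCast
      (m := 21) (by norm_num)
end
end

section
/- Let 0 < x ≤ 1, let 1 ≤ k ≤ n, and consider the profile with k agents at location x and n − k agents at location 0 (so Nash(y) = (1 − y)^{n−k}·(1 − x + y)^k for y ∈ [0, x]). If k/n ≥ 1/(2 − x), then x is a Nash optimum for this profile. If k/n ≤ (1 − x)/(2 − x), then 0 is a Nash optimum. If neither inequality holds, then x − 1 + (2k − kx)/n is a Nash optimum. -/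
open Set

noncomputable section

theorem pow_mul_pow_le_of_weighted_le (m k : ℕ) {a b A B : ℝ} (ha : 0 ≤ a) (hb : 0 ≤ b)
    (hA : 0 < A) (hB : 0 < B) (h : m * (a * B) + k * (b * A) ≤ (m + k) * (A * B)) :
    b ^ k * a ^ m ≤ B ^ k * A ^ m := by
  have pow_le_exp (t : ℝ) (ht : 0 ≤ t) (j : ℕ) : t ^ j ≤ Real.exp (j * (t - 1)) := by
    rw [Real.exp_nat_mul]
    exact pow_le_pow_left₀ ht (by linarith [Real.add_one_le_exp (t - 1)]) j
  have hsum : k * (b / B - 1) + m * (a / A - 1) ≤ 0 := by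
    have heq : k * (b / B - 1) + m * (a / A - 1)
        = (m * (a * B) + k * (b * A) - (m + k) * (A * B)) / (A * B) := by
      field_simp
      ring
    rw [heq]
    exact div_nonpos_of_nonpos_of_nonneg (by linarith) (by positivity)
  have hratio : (b / B) ^ k * (a / A) ^ m ≤ 1 :=
    calc (b / B) ^ k * (a / A) ^ m
        ≤ Real.exp (k * (b / B - 1)) * Real.exp (m * (a / A - 1)) :=
          mul_le_mul (pow_le_exp _ (by positivity) k) (pow_le_exp _ (by positivity) m)
            (by positivity) (by positivity)
      _ ≤ 1 := by rwa [← Real.exp_add, Real.exp_le_one_iff]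
  rwa [div_pow, div_pow, div_mul_div_comm, div_le_one (by positivity)] at hratio

theorem util_zero {y : ℝ} (hy : 0 ≤ y) : util y 0 = 1 - y := by
  simp [util, abs_of_nonneg hy]

theorem util_of_le {y z : ℝ} (h : y ≤ z) : util y z = 1 - z + y := by
  rw [util, abs_of_nonpos (by linarith)]
  ring

theorem util_le (y z : ℝ) : util y z ≤ 1 - z + y := by
  unfold util
  linarith [neg_abs_le (y - z)]

theorem util_le_one (y z : ℝ) : util y z ≤ 1 := by
  unfold util
  linarith [abs_nonneg (y - z)]

theorem nash_eq_of_two_locations (k m : ℕ) (xv : ℝ) (x : Fin (k + m) → ℝ)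
    (hx : ∀ i, x i = if (i : ℕ) < k then xv else 0) (y : ℝ) :
    nash y x = util y xv ^ k * util y 0 ^ m := by
  simp [nash, hx, Fin.prod_univ_add]

theorem isNashOpt_of_weighted_le (k m : ℕ) {xv y : ℝ} (hxv : xv ∈ Icc (0 : ℝ) 1)
    (x : Fin (k + m) → ℝ) (hx : ∀ i, x i = if (i : ℕ) < k then xv else 0)
    (hy₀ : 0 ≤ y) (hy₁ : y ≤ xv) (hA : 0 < 1 - y) (hB : 0 < 1 - xv + y)
    (h : ∀ z ∈ Icc (0 : ℝ) 1,
      m * ((1 - z) * (1 - xv + y)) + k * (util z xv * (1 - y))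
        ≤ (m + k) * ((1 - y) * (1 - xv + y))) :
    isNashOpt x y := by
  refine ⟨⟨hy₀, hy₁.trans hxv.2⟩, fun z hz => ?_⟩
  rw [nash_eq_of_two_locations k m xv x hx, nash_eq_of_two_locations k m xv x hx,
    util_zero hz.1, util_zero hy₀, util_of_le hy₁]
  exact pow_mul_pow_le_of_weighted_le m k (by linarith [hz.2]) (util_nonneg hz hxv) hA hB (h z hz)

theorem nashFL_two_locations (n k : ℕ) (hk₁ : 1 ≤ k) (hk₂ : k ≤ n)
    (xv : ℝ) (hxv₁ : 0 < xv) (hxv₂ : xv ≤ 1)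
    (x : Fin n → ℝ) (hx : ∀ i, x i = if (i : ℕ) < k then xv else 0) :
    ((k : ℝ) / n ≥ 1 / (2 - xv) → isNashOpt x xv) ∧
    ((k : ℝ) / n ≤ (1 - xv) / (2 - xv) → isNashOpt x 0) ∧
    (¬((k : ℝ) / n ≥ 1 / (2 - xv)) → ¬((k : ℝ) / n ≤ (1 - xv) / (2 - xv)) →
      isNashOpt x (xv - 1 + (2 * k - k * xv) / n)) := by
  obtain ⟨m, rfl⟩ := Nat.exists_eq_add_of_le hk₂
  have hk : (1 : ℝ) ≤ k := by exact_mod_cast hk₁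
  have hm : (0 : ℝ) ≤ m := m.cast_nonneg
  have hn : (0 : ℝ) < k + m := by linarith
  have hxv : xv ∈ Icc (0 : ℝ) 1 := ⟨hxv₁.le, hxv₂⟩
  have h2 : 0 < 2 - xv := by linarith
  push_cast
  rw [ge_iff_le, div_le_div_iff₀ h2 hn, div_le_div_iff₀ hn h2]
  refine ⟨fun h => ?_, fun h => ?_, fun h₁ h₂ => ?_⟩
  · rcases hxv₂.eq_or_lt with rfl | hlt
    · have hm0 : m = 0 := by
        have : (m : ℝ) ≤ 0 := by linarith
        exact_mod_cast le_antisymm this hm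
      subst hm0
      refine ⟨hxv, fun z hz => ?_⟩
      rw [nash_eq_of_two_locations k 0 1 x hx, nash_eq_of_two_locations k 0 1 x hx,
        util_of_le le_rfl]
      simpa using pow_le_one₀ (n := k) (util_nonneg hz hxv) (util_le_one z 1)
    · refine isNashOpt_of_weighted_le k m hxv x hx hxv₁.le le_rfl (by linarith) (by linarith)
        fun z hz => ?_
      rcases le_total z xv with hzx | hzx
      · rw [util_of_le hzx]
        nlinarith [mul_nonneg (sub_nonneg.2 h) (sub_nonneg.2 hzx)]
      · nlinarith [mul_nonneg hm (sub_nonneg.2 hzx),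
          mul_nonneg (mul_nonneg (by linarith : (0 : ℝ) ≤ k) (sub_nonneg.2 hxv₂))
            (sub_nonneg.2 (util_le_one z xv))]
  · have hlt : xv < 1 := by
      refine hxv₂.lt_of_ne ?_
      rintro rfl
      linarith
    refine isNashOpt_of_weighted_le k m hxv x hx le_rfl hxv₁.le (by linarith) (by linarith)
      fun z hz => ?_
    nlinarith [mul_nonneg (sub_nonneg.2 h) hz.1,
      mul_nonneg (by linarith : (0 : ℝ) ≤ k) (sub_nonneg.2 (util_le z xv))]
  · rw [not_le] at h₁ h₂
    set y := xv - 1 + (2 * k - k * xv) / (k + m) with hy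
    have hB : 1 - xv + y = (2 - xv) * k / (k + m) := by
      rw [hy]
      ring
    have hA : 1 - y = (2 - xv) * m / (k + m) := by
      rw [hy]
      field_simp
      ring
    have hy₀ : 0 < y := by
      have : 1 - xv < (2 - xv) * k / (k + m) := by
        rw [lt_div_iff₀ hn]
        linarith
      linarith
    have hy₁ : y < xv := by
      have : (2 - xv) * k / (k + m) < 1 := by
        rw [div_lt_one hn]
        linarith
      linarith
    refine isNashOpt_of_weighted_le k m hxv x hx hy₀.le hy₁.le (by linarith) (by linarith)
      fun z hz => ?_
    rw [hA, hB]
    have hc : 0 ≤ (2 - xv) * k * m / (k + m) := by positivity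
    have hle := mul_le_mul_of_nonneg_left
      (by linarith [util_le z xv] : 1 - z + util z xv ≤ 2 - xv) hc
    calc m * ((1 - z) * ((2 - xv) * k / (k + m))) + k * (util z xv * ((2 - xv) * m / (k + m)))
        = (2 - xv) * k * m / (k + m) * (1 - z + util z xv) := by ring
      _ ≤ (2 - xv) * k * m / (k + m) * (2 - xv) := hle
      _ = (m + k) * ((2 - xv) * m / (k + m) * ((2 - xv) * k / (k + m))) := by
        field_simp
        ring
end
end

section
/- The midpoint mechanism (2 − 2/n)-approximates the utilitarian social welfare: for every profile x ∈ [0,1]^n (n ≥ 2) and every y ∈ [0,1], USW(y, x) ≤ (2 − 2/n)·USW(Mid(x), x). Moreover this bound is tight: for the profile with n − 1 agents at 0 and one agent at 1, the maximum of USW(y, x) over y ∈ [0,1] equals (2 − 2/n)·USW(Mid(x), x). -/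
open Set

noncomputable section

/-- Utilitarian social welfare: sum of agents' utilities. -/
def usw {n : ℕ} (y : ℝ) (x : Fin n → ℝ) : ℝ := ∑ i, util y (x i)

/-- The midpoint mechanism. -/
def mid {n : ℕ} (x : Fin n → ℝ) : ℝ := ((⨅ i, x i) + (⨆ i, x i)) / 2

lemma ciSup_sub_ciInf_le_sum_abs_sub {ι : Type*} [Fintype ι] [Nonempty ι] (x : ι → ℝ) (y : ℝ) :
    (⨆ i, x i) - (⨅ i, x i) ≤ ∑ i, |y - x i| := by
  classical
  obtain ⟨p, hp⟩ := exists_eq_ciInf_of_finite (f := x)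
  obtain ⟨q, hq⟩ := exists_eq_ciSup_of_finite (f := x)
  rw [← hp, ← hq]
  rcases eq_or_ne p q with rfl | hpq
  · simpa using Finset.sum_nonneg fun i _ => abs_nonneg (y - x i)
  · calc x q - x p ≤ |y - x p| + |y - x q| := by
          linarith [le_abs_self (y - x p), neg_abs_le (y - x q)]
      _ = ∑ i ∈ {p, q}, |y - x i| := (Finset.sum_pair (f := fun i => |y - x i|) hpq).symm
      _ ≤ ∑ i, |y - x i| :=
          Finset.sum_le_sum_of_subset_of_nonneg (Finset.subset_univ _)
            fun i _ _ => abs_nonneg _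

lemma usw_eq_sub {n : ℕ} (y : ℝ) (x : Fin n → ℝ) : usw y x = n - ∑ i, |y - x i| := by
  simp [usw, util]

lemma abs_mid_sub_le {n : ℕ} (x : Fin n → ℝ) (i : Fin n) :
    |mid x - x i| ≤ ((⨆ j, x j) - ⨅ j, x j) / 2 := by
  have hinf := ciInf_le (finite_range x).bddBelow i
  have hsup := le_ciSup (finite_range x).bddAbove i
  rw [mid, abs_le]
  constructor <;> linarith

lemma usw_le_mul_usw_mid {n : ℕ} (hn : 2 ≤ n) (x : Fin n → ℝ)
    (hx : ∀ i, x i ∈ Set.Icc (0 : ℝ) 1) (y : ℝ) :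
    usw y x ≤ (2 - 2 / (n : ℝ)) * usw (mid x) x := by
  have : Nonempty (Fin n) := ⟨⟨0, by lia⟩⟩
  have hn' : (2 : ℝ) ≤ n := by exact_mod_cast hn
  have hy := ciSup_sub_ciInf_le_sum_abs_sub x y
  have hm : ∑ i, |mid x - x i| ≤ n * (((⨆ j, x j) - ⨅ j, x j) / 2) := by
    simpa using Finset.sum_le_card_nsmul Finset.univ _ _ fun i _ => abs_mid_sub_le x i
  have hinf : 0 ≤ ⨅ j, x j := le_ciInf fun i => (hx i).1
  have hsup : (⨆ j, x j) ≤ 1 := ciSup_le fun i => (hx i).2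
  rw [usw_eq_sub, usw_eq_sub]
  set d := (⨆ j, x j) - ⨅ j, x j
  have hd : d ≤ 1 := by linarith
  have hc : 0 ≤ 2 - 2 / (n : ℝ) := by
    rw [sub_nonneg, div_le_iff₀ (by linarith)]
    linarith
  calc (n : ℝ) - ∑ i, |y - x i| ≤ n - d := by linarith
    _ ≤ (n - 1) * (2 - d) := by nlinarith
    _ = (2 - 2 / (n : ℝ)) * (n - n * (d / 2)) := by
        field_simp
    _ ≤ (2 - 2 / (n : ℝ)) * (n - ∑ i, |mid x - x i|) := by gcongr

theorem mid_utilitarian_approx (n : ℕ) (hn : 2 ≤ n) :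
    (∀ x : Fin n → ℝ, (∀ i, x i ∈ Set.Icc (0 : ℝ) 1) →
      ∀ y ∈ Set.Icc (0 : ℝ) 1, usw y x ≤ (2 - 2 / (n : ℝ)) * usw (mid x) x) ∧
    (∀ x : Fin n → ℝ, (∀ i, x i = if (i : ℕ) < n - 1 then 0 else 1) →
      IsGreatest ((fun y => usw y x) '' Set.Icc (0 : ℝ) 1)
        ((2 - 2 / (n : ℝ)) * usw (mid x) x)) := by
  refine ⟨fun x hx y _ => usw_le_mul_usw_mid hn x hx y, fun x hx => ?_⟩
  have hmem : ∀ i, x i ∈ Set.Icc (0 : ℝ) 1 := by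
    intro i
    rw [hx]
    split_ifs <;> simp
  refine ⟨⟨0, by simp, ?_⟩, ?_⟩
  · obtain ⟨m, rfl⟩ : ∃ m, n = m + 1 := ⟨n - 1, by lia⟩
    have hcast : ∀ i : Fin m, x i.castSucc = 0 := fun i => by simp [hx]
    have hlast : x (Fin.last m) = 1 := by simp [hx]
    have hinf : ⨅ i, x i = 0 :=
      le_antisymm
        ((ciInf_le (finite_range x).bddBelow _).trans_eq (hcast ⟨0, by lia⟩))
        (le_ciInf fun i => (hmem i).1)
    have hsup : ⨆ i, x i = 1 :=
      le_antisymm (ciSup_le fun i => (hmem i).2)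
        (hlast.symm.trans_le (le_ciSup (finite_range x).bddAbove _))
    have hmid : mid x = 1 / 2 := by rw [mid, hinf, hsup, zero_add]
    have h0 : usw 0 x = m := by
      simp [usw, util, Fin.sum_univ_castSucc, hcast, hlast]
    have h1 : usw (1 / 2) x = (m + 1) / 2 := by
      simp only [usw, util, Fin.sum_univ_castSucc, hcast, hlast]
      norm_num [abs_of_nonneg, abs_of_neg]
      ring
    have hm : (m : ℝ) + 1 ≠ 0 := by positivity
    simp only [hmid, h0, h1]
    push_cast
    field_simp
    ring
  · rintro _ ⟨y, -, rfl⟩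
    exact usw_le_mul_usw_mid hn x hmem y
end
end

section
/- For n ≥ 2, consider the profile x with n − 1 agents at 0 and one agent at 1. Then y* = 1/n is a Nash optimum for x with Nash(1/n, x) = (n − 1)^{n−1}/n^n, while Mid(x) = 1/2 and Nash(1/2, x) = 1/2^n; hence the ratio Nash(y*, x)/Nash(Mid(x), x) equals (2^n/n)·((n − 1)/n)^{n−1}. In particular, the approximation ratio of the midpoint mechanism for Nash welfare is at least (2^n/n)·((n − 1)/n)^{n−1}. -/
open Set

noncomputable section

lemma pow_mul_succ_sub_mul_le_one {t : ℝ} (ht : 0 ≤ t) (m : ℕ) :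
    t ^ m * ((m + 1) - m * t) ≤ 1 := by
  induction m with
  | zero => simp
  | succ m ih =>
    have h : 0 ≤ t ^ m * ((m + 1) * (t - 1) ^ 2) := by positivity
    push_cast
    rw [pow_succ]
    linarith

lemma one_sub_pow_mul_self_le {m : ℕ} (hm : m ≠ 0) {z : ℝ} (hz : z ≤ 1) :
    (1 - z) ^ m * z ≤ (m : ℝ) ^ m / ((m : ℝ) + 1) ^ (m + 1) := by
  have hm' : (0 : ℝ) < m := by positivity
  obtain ⟨t, rfl⟩ : ∃ t : ℝ, z = 1 - m * t / (m + 1) :=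
    ⟨(m + 1) * (1 - z) / m, by field_simp; ring⟩
  have ht : 0 ≤ t := by
    have h : 0 ≤ m * t / (m + 1) := by linarith
    rw [mul_div_right_comm] at h
    exact nonneg_of_mul_nonneg_right h (by positivity)
  calc (1 - (1 - m * t / (m + 1))) ^ m * (1 - m * t / (m + 1))
      = (m : ℝ) ^ m / ((m : ℝ) + 1) ^ (m + 1) * (t ^ m * ((m + 1) - m * t)) := by
        rw [sub_sub_cancel, div_pow, mul_pow, pow_succ]
        field_simp
    _ ≤ _ := mul_le_of_le_one_right (by positivity) (pow_mul_succ_sub_mul_le_one ht m)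

lemma nash_of_all_but_last_at_zero {m : ℕ} {x : Fin (m + 1) → ℝ}
    (hx : ∀ i, x i = if (i : ℕ) < m then 0 else 1) {z : ℝ} (hz : z ∈ Set.Icc (0 : ℝ) 1) :
    nash z x = (1 - z) ^ m * z := by
  have h₁ : |z - 1| = 1 - z := by rw [abs_sub_comm, abs_of_nonneg (sub_nonneg.2 hz.2)]
  simp [nash, util, Fin.prod_univ_castSucc, hx, abs_of_nonneg hz.1, h₁]

lemma mid_of_all_but_last_at_zero {m : ℕ} (hm : m ≠ 0) {x : Fin (m + 1) → ℝ}
    (hx : ∀ i, x i = if (i : ℕ) < m then 0 else 1) : mid x = 1 / 2 := by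
  have h₀ : x 0 = 0 := by simp [hx, Nat.pos_of_ne_zero hm]
  have h₁ : x (Fin.last m) = 1 := by simp [hx]
  have hinf : IsLeast (Set.range x) 0 :=
    ⟨⟨0, h₀⟩, by rintro _ ⟨i, rfl⟩; rw [hx]; split_ifs <;> norm_num⟩
  have hsup : IsGreatest (Set.range x) 1 :=
    ⟨⟨_, h₁⟩, by rintro _ ⟨i, rfl⟩; rw [hx]; split_ifs <;> norm_num⟩
  rw [mid, iInf, iSup, hinf.csInf_eq, hsup.csSup_eq, zero_add]

theorem mid_nash_lower_bound (n : ℕ) (hn : 2 ≤ n) (x : Fin n → ℝ)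
    (hx : ∀ i, x i = if (i : ℕ) < n - 1 then 0 else 1) :
    isNashOpt x (1 / (n : ℝ)) ∧
    nash (1 / (n : ℝ)) x = ((n : ℝ) - 1) ^ (n - 1) / (n : ℝ) ^ n ∧
    mid x = 1 / 2 ∧
    nash (1 / 2) x = 1 / 2 ^ n ∧
    nash (1 / (n : ℝ)) x / nash (mid x) x =
      (2 ^ n / (n : ℝ)) * (((n : ℝ) - 1) / n) ^ (n - 1) := by
  obtain ⟨m, rfl⟩ : ∃ m, n = m + 1 := ⟨n - 1, by omega⟩
  have hm : m ≠ 0 := by omega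
  simp only [Nat.add_sub_cancel] at hx ⊢
  push_cast
  rw [add_sub_cancel_right]
  have hmem : 1 / ((m : ℝ) + 1) ∈ Set.Icc (0 : ℝ) 1 :=
    ⟨by positivity, (div_le_one (by positivity)).2 (by linarith [m.cast_nonneg (α := ℝ)])⟩
  have hopt : nash (1 / ((m : ℝ) + 1)) x = (m : ℝ) ^ m / ((m : ℝ) + 1) ^ (m + 1) := by
    have h : 1 - 1 / ((m : ℝ) + 1) = m / (m + 1) := by field_simp; ring
    rw [nash_of_all_but_last_at_zero hx hmem, h, div_pow, pow_succ]
    field_simp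
  have hmid : mid x = 1 / 2 := mid_of_all_but_last_at_zero hm hx
  have hhalf : nash (1 / 2) x = 1 / 2 ^ (m + 1) := by
    have h : (1 : ℝ) - 1 / 2 = 1 / 2 := by norm_num
    rw [nash_of_all_but_last_at_zero hx ⟨by norm_num, by norm_num⟩, h, ← pow_succ, one_div_pow]
  refine ⟨⟨hmem, fun z hz => ?_⟩, hopt, hmid, hhalf, ?_⟩
  · rw [hopt, nash_of_all_but_last_at_zero hx hz]
    exact one_sub_pow_mul_self_le hm hz.2
  · rw [hmid, hhalf, hopt, div_pow, pow_succ ((m : ℝ) + 1)]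
    field_simp
end
end

section
/- The Nash optimum satisfies Unanimous Fair Share: let x ∈ [0,1]^n be a profile, let z ∈ [0,1] be a location, and suppose at least k of the n agents are located exactly at z (1 ≤ k ≤ n). Then for every Nash optimum y* for x, the utility of each such agent satisfies 1 − |y* − z| ≥ k/n. -/
open Set

noncomputable section

/-- If `∏ (1 + t a i) ≤ 1` for all `t ∈ (0, 1)`, then `∑ a i ≤ 0`. -/
theorem sum_nonpos_of_prod_one_add_mul_le_one {ι : Type*} [Fintype ι] (a : ι → ℝ)
    (h : ∀ t ∈ Ioo (0 : ℝ) 1, ∏ i, (1 + t * a i) ≤ 1) : ∑ i, a i ≤ 0 := by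
  classical
  have hd : HasDerivAt (fun t : ℝ => ∏ i, (1 + t * a i)) (∑ i, a i) 0 := by
    have := HasDerivAt.fun_finsetProd (u := Finset.univ) (f := fun i (t : ℝ) => 1 + t * a i)
      (f' := a) (x := 0) fun i _ => by
        simpa using ((hasDerivAt_id (0 : ℝ)).mul_const (a i)).const_add 1
    simpa using this
  have ht := (hasDerivWithinAt_iff_tendsto_slope' (s := Ioi (0 : ℝ)) (by simp)).1
    hd.hasDerivWithinAt
  refine le_of_tendsto ht ?_
  filter_upwards [Ioo_mem_nhdsGT (zero_lt_one (α := ℝ))] with t ht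
  have := h t ht
  simp only [slope_def_field, zero_mul, add_zero, Finset.prod_const_one, sub_zero]
  exact div_nonpos_of_nonpos_of_nonneg (by linarith) ht.1.le

/-- Utility is concave in the facility location. -/
theorem util_concave (y z w : ℝ) {t : ℝ} (ht : t ∈ Ioo (0 : ℝ) 1) :
    (1 - t) * util y w + t * util z w ≤ util ((1 - t) * y + t * z) w := by
  have h := abs_add_le ((1 - t) * (y - w)) (t * (z - w))
  rw [abs_mul, abs_mul, abs_of_pos ht.1, abs_of_pos (sub_pos.2 ht.2)] at h
  have e : (1 - t) * y + t * z - w = (1 - t) * (y - w) + t * (z - w) := by ring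
  unfold util
  rw [e]
  linarith

theorem isNashOpt.nash_pos {n : ℕ} {x : Fin n → ℝ} (hx : ∀ i, x i ∈ Icc (0 : ℝ) 1) {y : ℝ}
    (hy : isNashOpt x y) : 0 < nash y x := by
  refine lt_of_lt_of_le (Finset.prod_pos fun i _ => ?_) (hy.2 (1 / 2) (by norm_num))
  have : |1 / 2 - x i| ≤ 1 / 2 := abs_le.2 ⟨by linarith [(hx i).2], by linarith [(hx i).1]⟩
  unfold util
  linarith

theorem isNashOpt.util_pos {n : ℕ} {x : Fin n → ℝ} (hx : ∀ i, x i ∈ Icc (0 : ℝ) 1) {y : ℝ}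
    (hy : isNashOpt x y) (i : Fin n) : 0 < util y (x i) :=
  lt_of_le_of_ne (util_nonneg hy.1 (hx i)) fun h =>
    (hy.nash_pos hx).ne' (Finset.prod_eq_zero (Finset.mem_univ i) h.symm)

/-- First-order optimality condition for the Nash welfare. -/
theorem isNashOpt.sum_util_div_le {n : ℕ} {x : Fin n → ℝ} (hx : ∀ i, x i ∈ Icc (0 : ℝ) 1)
    {y z : ℝ} (hy : isNashOpt x y) (hz : z ∈ Icc (0 : ℝ) 1) :
    ∑ i, util z (x i) / util y (x i) ≤ n := by
  have hpos := hy.util_pos hx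
  have key := sum_nonpos_of_prod_one_add_mul_le_one
    (fun i => util z (x i) / util y (x i) - 1) fun t ht => by
      have hw : (1 - t) * y + t * z ∈ Icc (0 : ℝ) 1 :=
        convex_Icc (0 : ℝ) 1 hy.1 hz (sub_pos.2 ht.2).le ht.1.le (by ring)
      refine le_trans (b := nash ((1 - t) * y + t * z) x / nash y x) ?_
        (div_le_one_of_le₀ (hy.2 _ hw) (hy.nash_pos hx).le)
      unfold nash
      rw [← Finset.prod_div_distrib]
      have e : ∀ i, 1 + t * (util z (x i) / util y (x i) - 1)
          = ((1 - t) * util y (x i) + t * util z (x i)) / util y (x i) := fun i => by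
        have := (hpos i).ne'
        field_simp
        ring
      refine Finset.prod_le_prod (fun i _ => ?_) fun i _ => ?_
      · rw [e]
        exact div_nonneg (add_nonneg (mul_nonneg (sub_pos.2 ht.2).le (hpos i).le)
          (mul_nonneg ht.1.le (util_nonneg hz (hx i)))) (hpos i).le
      · rw [e]
        exact div_le_div_of_nonneg_right (util_concave y z (x i) ht) (hpos i).le
  simpa using key

theorem nashFL_unanimous_fair_share (n k : ℕ) (hk₁ : 1 ≤ k) (hk₂ : k ≤ n)
    (x : Fin n → ℝ) (hx : ∀ i, x i ∈ Set.Icc (0 : ℝ) 1)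
    (z : ℝ) (hz : z ∈ Set.Icc (0 : ℝ) 1)
    (hcount : k ≤ Set.ncard {i : Fin n | x i = z}) :
    ∀ ystar, isNashOpt x ystar → 1 - |ystar - z| ≥ (k : ℝ) / n := by
  intro y hy
  classical
  set S : Finset (Fin n) := Finset.univ.filter fun i => x i = z with hS
  have hcard : k ≤ S.card := by
    rw [← Set.ncard_coe_finset]
    simpa [hS] using hcount
  obtain ⟨j, hj⟩ : S.Nonempty := Finset.card_pos.1 (by omega)
  have hjz : x j = z := (Finset.mem_filter.1 hj).2
  have hpos : 0 < util y z := hjz ▸ hy.util_pos hx j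
  have hsum : (S.card : ℝ) / util y z ≤ n := by
    refine le_trans (le_of_eq ?_) ((Finset.sum_le_univ_sum_of_nonneg (s := S) fun i =>
      div_nonneg (util_nonneg hz (hx i)) (hy.util_pos hx i).le).trans (hy.sum_util_div_le hx hz))
    rw [Finset.sum_congr rfl (g := fun _ => 1 / util y z) fun i hi => by
      rw [(Finset.mem_filter.1 hi).2]
      simp [util]]
    simp [div_eq_mul_inv]
  have hn : (0 : ℝ) < n := by
    exact_mod_cast (show 0 < n by omega)
  change (k : ℝ) / n ≤ util y z
  rw [div_le_iff₀ hpos] at hsum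
  rw [div_le_iff₀ hn]
  have : (k : ℝ) ≤ S.card := by exact_mod_cast hcard
  linarith
end
end

section
/- The midpoint mechanism does not satisfy Unanimous Fair Share: for every n ≥ 3, in the profile with n − 1 agents at location 0 and one agent at location 1, Mid(x) = 1/2, each of the n − 1 agents at 0 receives utility 1/2, and 1/2 < (n − 1)/n. -/
open Set

noncomputable section

theorem mid_fails_ufs (n : ℕ) (hn : 3 ≤ n) (x : Fin n → ℝ)
    (hx : ∀ i, x i = if (i : ℕ) < n - 1 then 0 else 1) :
    mid x = 1 / 2 ∧
    (∀ i : Fin n, (i : ℕ) < n - 1 → util (mid x) (x i) = 1 / 2) ∧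
    (1 / 2 : ℝ) < ((n : ℝ) - 1) / n := by
  have hmin : IsLeast (range x) 0 :=
    ⟨⟨⟨0, by omega⟩, by rw [hx, if_pos (by simp only; omega)]⟩, by
      rintro _ ⟨i, rfl⟩
      rw [hx]
      split_ifs <;> norm_num⟩
  have hmax : IsGreatest (range x) 1 :=
    ⟨⟨⟨n - 1, by omega⟩, by rw [hx, if_neg (by simp)]⟩, by
      rintro _ ⟨i, rfl⟩
      rw [hx]
      split_ifs <;> norm_num⟩
  have hmid : mid x = 1 / 2 := by
    rw [mid, iInf, iSup, hmin.csInf_eq, hmax.csSup_eq, zero_add]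
  refine ⟨hmid, fun i hi => ?_, ?_⟩
  · rw [hmid, hx, if_pos hi, util, sub_zero, abs_of_pos (by norm_num)]
    norm_num
  · have hn' : (3 : ℝ) ≤ n := by exact_mod_cast hn
    rw [div_lt_div_iff₀ (by norm_num) (by linarith)]
    linarith
end
end

section
/- The MidOrNearest mechanism 2^{n−2}-approximates the Nash welfare for n ≥ 3: for every profile x ∈ [0,1]^n with n ≥ 3 and every y ∈ [0,1], Nash(y, x) ≤ 2^{n−2}·Nash(MidOrNearest(x), x). -/
open Set

noncomputable section

/-- The MidOrNearest mechanism. -/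
def midOrNearest {n : ℕ} (x : Fin n → ℝ) : ℝ :=
  if (⨅ i, x i) ≤ 1/2 ∧ 1/2 ≤ (⨆ i, x i) then 1/2
  else if (⨆ i, x i) < 1/2 then ⨆ i, x i
  else ⨅ i, x i

theorem util_reflect (y z : ℝ) : util (1 - y) (1 - z) = util y z := by
  unfold util
  rw [show 1 - y - (1 - z) = -(y - z) by ring, abs_neg]

theorem nash_reflect {n : ℕ} (y : ℝ) (x : Fin n → ℝ) :
    nash (1 - y) (fun i => 1 - x i) = nash y x := by
  simp only [nash, util_reflect]

/-- If every utility ratio is at most `k`, and some agent's ratio is at most `r`, then the ratio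
of Nash welfares is at most `k ^ (n - 1) * r`, which is bounded when `k ≤ 2` and `k ^ 2 * r ≤ 2`. -/
theorem nash_le_of_util_le {n : ℕ} (hn : 3 ≤ n) {x : Fin n → ℝ}
    (hx : ∀ i, x i ∈ Icc (0 : ℝ) 1) {y m k r : ℝ} (hy : y ∈ Icc (0 : ℝ) 1)
    (hm : m ∈ Icc (0 : ℝ) 1) (hk : 0 ≤ k) (hk2 : k ≤ 2) (hr : 0 ≤ r) (hkr : k ^ 2 * r ≤ 2)
    (h : ∀ i, util y (x i) ≤ k * util m (x i)) (a : Fin n)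
    (ha : util y (x a) ≤ r * util m (x a)) :
    nash y x ≤ 2 ^ (n - 2) * nash m x := by
  have hcard : (Finset.univ.erase a).card = n - 1 := by
    rw [Finset.card_erase_of_mem (Finset.mem_univ a), Finset.card_univ, Fintype.card_fin]
  have hprod : ∏ i ∈ Finset.univ.erase a, util y (x i)
      ≤ k ^ (n - 1) * ∏ i ∈ Finset.univ.erase a, util m (x i) := by
    rw [← hcard, ← Finset.prod_const, ← Finset.prod_mul_distrib]
    exact Finset.prod_le_prod (fun i _ => util_nonneg hy (hx i)) fun i _ => h i
  have hconst : r * k ^ (n - 1) ≤ 2 ^ (n - 2) := by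
    obtain ⟨j, rfl⟩ := Nat.exists_eq_add_of_le' hn
    have e1 : j + 3 - 1 = j + 2 := by omega
    have e2 : j + 3 - 2 = j + 1 := by omega
    rw [e1, e2]
    calc r * k ^ (j + 2) = k ^ j * (k ^ 2 * r) := by ring
      _ ≤ 2 ^ j * 2 := by gcongr
      _ = 2 ^ (j + 1) := by ring
  have hm0 : 0 ≤ nash m x := Finset.prod_nonneg fun i _ => util_nonneg hm (hx i)
  calc nash y x = util y (x a) * ∏ i ∈ Finset.univ.erase a, util y (x i) :=
        (Finset.mul_prod_erase _ _ (Finset.mem_univ a)).symm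
    _ ≤ (r * util m (x a)) * (k ^ (n - 1) * ∏ i ∈ Finset.univ.erase a, util m (x i)) :=
        mul_le_mul ha hprod (Finset.prod_nonneg fun i _ => util_nonneg hy (hx i))
          (mul_nonneg hr (util_nonneg hm (hx a)))
    _ = (r * k ^ (n - 1)) * nash m x := by
        rw [nash, ← Finset.mul_prod_erase _ _ (Finset.mem_univ a)]
        ring
    _ ≤ 2 ^ (n - 2) * nash m x := mul_le_mul_of_nonneg_right hconst hm0

theorem nash_le_half_of_half_le {n : ℕ} (hn : 3 ≤ n) {x : Fin n → ℝ}
    (hx : ∀ i, x i ∈ Icc (0 : ℝ) 1) {y : ℝ} (hy : y ∈ Icc (0 : ℝ) 1) (hy2 : 1 / 2 ≤ y)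
    (a : Fin n) (ha : x a ≤ 1 / 2) :
    nash y x ≤ 2 ^ (n - 2) * nash (1 / 2) x := by
  obtain ⟨hy0, hy1⟩ := hy
  refine nash_le_of_util_le (k := 2 * y) (r := 3 / 2 - y) hn hx ⟨hy0, hy1⟩
    ⟨by norm_num, by norm_num⟩ (by linarith) (by linarith) (by linarith) ?_ ?_ a ?_
  · nlinarith [mul_nonneg (sq_nonneg (1 - y)) (by linarith : 0 ≤ 1 + 2 * y)]
  · intro i
    obtain ⟨h0, h1⟩ := hx i
    unfold util
    rcases abs_cases (y - x i) with ⟨e, _⟩ | ⟨e, _⟩ <;>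
      rcases abs_cases (1 / 2 - x i) with ⟨e', _⟩ | ⟨e', _⟩ <;> rw [e, e'] <;>
      nlinarith [mul_nonneg (sub_nonneg.2 hy2) (sub_nonneg.2 h1),
        mul_nonneg (sub_nonneg.2 hy2) h0, mul_nonneg (sub_nonneg.2 hy2) (sub_nonneg.2 hy1)]
  · obtain ⟨h0, h1⟩ := hx a
    unfold util
    rw [abs_of_nonneg (by linarith), abs_of_nonneg (by linarith)]
    nlinarith [mul_nonneg (sub_nonneg.2 hy2) h0, mul_nonneg (sub_nonneg.2 hy2) (sub_nonneg.2 ha)]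

theorem nash_le_max {n : ℕ} (hn : 3 ≤ n) {x : Fin n → ℝ}
    (hx : ∀ i, x i ∈ Icc (0 : ℝ) 1) {y : ℝ} (hy : y ∈ Icc (0 : ℝ) 1)
    (a : Fin n) (ha : x a ≤ 1 / 2) (hmax : ∀ i, x i ≤ x a) :
    nash y x ≤ 2 ^ (n - 2) * nash (x a) x := by
  obtain ⟨hy0, hy1⟩ := hy
  have hxa := hx a
  rcases le_total (x a) y with hya | hya
  · have h : ∀ i, util y (x i) ≤ 1 * util (x a) (x i) := by
      intro i
      have := hmax i
      unfold util
      rw [abs_of_nonneg (by linarith), abs_of_nonneg (by linarith)]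
      linarith
    exact nash_le_of_util_le hn hx ⟨hy0, hy1⟩ hxa zero_le_one one_le_two zero_le_one
      (by norm_num) h a (h a)
  · have hd : 0 < 1 - x a := by linarith
    refine nash_le_of_util_le (k := (1 - y) / (1 - x a)) (r := 1 - x a + y) hn hx ⟨hy0, hy1⟩ hxa
      (div_nonneg (by linarith) hd.le) ?_ (by linarith) ?_ ?_ a ?_
    · rw [div_le_iff₀ hd]
      linarith
    · rw [div_pow, div_mul_eq_mul_div, div_le_iff₀ (by positivity)]
      obtain ⟨t, ht⟩ : ∃ t, t = 1 / 2 - x a := ⟨_, rfl⟩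
      have ht0 : 0 ≤ t := by linarith
      rw [show x a = 1 / 2 - t by linarith]
      nlinarith [mul_nonneg (sq_nonneg y) (by linarith : 0 ≤ 3 / 2 - y),
        mul_nonneg ht0 (mul_nonneg hy0 (by linarith : 0 ≤ 2 - y)), mul_nonneg ht0 ht0]
    · intro i
      obtain ⟨h0, h1⟩ := hx i
      have hi := hmax i
      unfold util
      rw [div_mul_eq_mul_div, le_div_iff₀ hd, abs_of_nonneg (sub_nonneg.2 hi)]
      rcases abs_cases (y - x i) with ⟨e, _⟩ | ⟨e, _⟩ <;> rw [e] <;>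
        nlinarith [mul_nonneg h0 (sub_nonneg.2 hya), mul_nonneg h0 (sub_nonneg.2 hi)]
    · unfold util
      rw [abs_of_nonpos (by linarith), sub_self, abs_zero]
      linarith

theorem midOrNearest_nash_approx (n : ℕ) (hn : 3 ≤ n) (x : Fin n → ℝ)
    (hx : ∀ i, x i ∈ Set.Icc (0 : ℝ) 1) :
    ∀ y ∈ Set.Icc (0 : ℝ) 1, nash y x ≤ 2 ^ (n - 2) * nash (midOrNearest x) x := by
  intro y hy
  have : Nonempty (Fin n) := ⟨⟨0, by omega⟩⟩
  obtain ⟨a, ha⟩ := exists_eq_ciInf_of_finite (f := x)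
  obtain ⟨b, hb⟩ := exists_eq_ciSup_of_finite (f := x)
  have hmin : ∀ i, x a ≤ x i := fun i => ha ▸ ciInf_le (finite_range x).bddBelow i
  have hmax : ∀ i, x i ≤ x b := fun i => hb ▸ le_ciSup (finite_range x).bddAbove i
  have hx' : ∀ i, 1 - x i ∈ Icc (0 : ℝ) 1 := fun i =>
    ⟨by linarith [(hx i).2], by linarith [(hx i).1]⟩
  have hy' : 1 - y ∈ Icc (0 : ℝ) 1 := ⟨by linarith [hy.2], by linarith [hy.1]⟩
  unfold midOrNearest
  rw [← ha, ← hb]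
  split_ifs with h1 h2
  · rcases le_total (1 / 2) y with h | h
    · exact nash_le_half_of_half_le hn hx hy h a h1.1
    · rw [← nash_reflect y, ← nash_reflect (1 / 2), show (1 : ℝ) - 1 / 2 = 1 / 2 by norm_num]
      exact nash_le_half_of_half_le hn hx' hy' (by linarith) b (by linarith [h1.2])
  · exact nash_le_max hn hx hy b h2.le hmax
  · have h3 : 1 / 2 ≤ x a := by
      by_contra! h
      exact h1 ⟨h.le, not_lt.1 h2⟩
    rw [← nash_reflect y, ← nash_reflect (x a)]
    exact nash_le_max hn hx' hy' a (by linarith) fun i => by linarith [hmin i]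
end
end

section
/- The MidOrNearest mechanism (2 − 2/n)-approximates the utilitarian social welfare: for every profile x ∈ [0,1]^n (n ≥ 2) and every y ∈ [0,1], USW(y, x) ≤ (2 − 2/n)·USW(MidOrNearest(x), x). -/
open Set

noncomputable section

lemma le_two_sub_mul_of_le {n : ℕ} (hn : 2 ≤ n) {S T : ℝ} (hS : 0 ≤ S) (hT : T ≤ S) :
    T ≤ (2 - 2 / (n : ℝ)) * S := by
  have hn' : (2 : ℝ) ≤ n := by exact_mod_cast hn
  have h : 2 / (n : ℝ) ≤ 1 := (div_le_one (by linarith)).2 hn'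
  nlinarith

lemma util_le_add_abs_sub (y m z : ℝ) : util y z ≤ util m z + |m - y| := by
  have := abs_sub_le m y z
  unfold util
  linarith

/-- If the facility at `m` gives everyone utility at least `1/2`, and some agent loses the full
distance when it moves to `y`, then moving gains at most a factor `2 - 2 / n`. -/
lemma usw_le_of_exists_util_add_le {n : ℕ} (hn : 2 ≤ n) {x : Fin n → ℝ} {m y : ℝ}
    (hd : |m - y| ≤ 1 / 2) (hm : ∀ k, 1 / 2 ≤ util m (x k))
    (hj : ∃ j, util y (x j) + |m - y| ≤ util m (x j)) :
    usw y x ≤ (2 - 2 / (n : ℝ)) * usw m x := by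
  obtain ⟨j, hj⟩ := hj
  have hn' : (2 : ℝ) ≤ n := by exact_mod_cast hn
  have hS : (n : ℝ) / 2 ≤ usw m x := by
    have := Finset.card_nsmul_le_sum Finset.univ (fun k => util m (x k)) (1 / 2) fun k _ => hm k
    simp only [Finset.card_univ, Fintype.card_fin, nsmul_eq_mul] at this
    unfold usw
    linarith
  have hT : usw y x ≤ usw m x + (n - 2) * |m - y| := by
    have hsum : ∑ k ∈ Finset.univ.erase j, util y (x k) ≤
        ∑ k ∈ Finset.univ.erase j, (util m (x k) + |m - y|) :=
      Finset.sum_le_sum fun k _ => util_le_add_abs_sub y m (x k)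
    rw [Finset.sum_add_distrib, Finset.sum_const, Finset.card_erase_of_mem (Finset.mem_univ j),
      Finset.card_univ, Fintype.card_fin, nsmul_eq_mul, Nat.cast_sub (by lia)] at hsum
    have hy := Finset.sum_erase_add Finset.univ (fun k => util y (x k)) (Finset.mem_univ j)
    have hm := Finset.sum_erase_add Finset.univ (fun k => util m (x k)) (Finset.mem_univ j)
    unfold usw
    push_cast at hsum
    linarith
  have hmul : (n - 2) * |m - y| ≤ (n - 2) * (usw m x / n) := by
    refine mul_le_mul_of_nonneg_left (hd.trans ?_) (by linarith)
    rw [le_div_iff₀ (by linarith)]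
    linarith
  have heq : (2 - 2 / (n : ℝ)) * usw m x = usw m x + (n - 2) * (usw m x / n) := by
    field_simp
    ring
  linarith

theorem midOrNearest_usw_approx (n : ℕ) (hn : 2 ≤ n) (x : Fin n → ℝ)
    (hx : ∀ i, x i ∈ Set.Icc (0 : ℝ) 1) :
    ∀ y ∈ Set.Icc (0 : ℝ) 1, usw y x ≤ (2 - 2 / (n : ℝ)) * usw (midOrNearest x) x := by
  rintro y ⟨hy0, hy1⟩
  have : Nonempty (Fin n) := ⟨⟨0, by lia⟩⟩
  obtain ⟨a, ha⟩ := exists_eq_ciInf_of_finite (f := x)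
  obtain ⟨b, hb⟩ := exists_eq_ciSup_of_finite (f := x)
  have hle : ∀ k, x a ≤ x k := fun k => ha ▸ ciInf_le (Set.finite_range x).bddBelow k
  have hge : ∀ k, x k ≤ x b := fun k => hb ▸ le_ciSup (Set.finite_range x).bddAbove k
  have hx0 : ∀ k, 0 ≤ x k := fun k => (hx k).1
  have hx1 : ∀ k, x k ≤ 1 := fun k => (hx k).2
  unfold midOrNearest
  rw [← ha, ← hb]
  split_ifs with h1 h2
  · refine usw_le_of_exists_util_add_le hn (by grind) (fun k => by grind [util]) ?_
    rcases le_total y (1 / 2) with h | h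
    · exact ⟨b, by grind [util]⟩
    · exact ⟨a, by grind [util]⟩
  · have hm : ∀ k, 1 / 2 ≤ util (x b) (x k) := fun k => by grind [util]
    rcases le_total y (x b) with h | h
    · exact usw_le_of_exists_util_add_le hn (by grind) hm ⟨b, by grind [util]⟩
    · exact le_two_sub_mul_of_le hn (Finset.sum_nonneg fun k _ => by linarith [hm k])
        (Finset.sum_le_sum fun k _ => by grind [util])
  · have hm : ∀ k, 1 / 2 ≤ util (x a) (x k) := fun k => by grind [util]
    rcases le_total y (x a) with h | h
    · exact le_two_sub_mul_of_le hn (Finset.sum_nonneg fun k _ => by linarith [hm k])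
        (Finset.sum_le_sum fun k _ => by grind [util])
    · exact usw_le_of_exists_util_add_le hn (by grind) hm ⟨a, by grind [util]⟩
end
end

section
/- The MidOrNearest mechanism (3/2)-approximates the egalitarian social welfare, and no strategy-proof mechanism has a smaller approximation ratio. That is: (i) for every profile x ∈ [0,1]^n and every y ∈ [0,1], ESW(y, x) ≤ (3/2)·ESW(MidOrNearest(x), x); and (ii) for n = 2, for every strategy-proof mechanism f : [0,1]^2 → [0,1] and every ρ < 3/2 there exists a profile x ∈ [0,1]^2 and y ∈ [0,1] with ESW(y, x) > ρ·ESW(f(x), x). -/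
open Set

noncomputable section

/-- Egalitarian social welfare: minimum utility of an agent. -/
def esw {n : ℕ} (y : ℝ) (x : Fin n → ℝ) : ℝ := ⨅ i, util y (x i)

/-- A profile of agent locations lies in `[0,1]^n`. -/
def inProfile {n : ℕ} (x : Fin n → ℝ) : Prop := ∀ i, x i ∈ Set.Icc (0 : ℝ) 1

/-- A deterministic mechanism is strategy-proof if no agent can increase her
utility by misreporting her location. -/
def strategyProof {n : ℕ} (f : (Fin n → ℝ) → ℝ) : Prop :=
  ∀ x : Fin n → ℝ, inProfile x → ∀ i : Fin n, ∀ xi' ∈ Set.Icc (0 : ℝ) 1,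
    util (f (Function.update x i xi')) (x i) ≤ util (f x) (x i)

theorem esw_le_util {n : ℕ} (y : ℝ) (x : Fin n → ℝ) (i : Fin n) : esw y x ≤ util y (x i) :=
  ciInf_le (Set.finite_range _).bddBelow i

theorem esw_pair (y a b : ℝ) : esw y ![a, b] = min (util y a) (util y b) := by
  apply le_antisymm
  · exact le_min (esw_le_util y ![a, b] 0) (esw_le_util y ![a, b] 1)
  · refine le_ciInf fun i => ?_
    fin_cases i
    · exact min_le_left _ _
    · exact min_le_right _ _

theorem esw_le_esw_midOrNearest {n : ℕ} (hn : 0 < n) (x : Fin n → ℝ)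
    (hx : ∀ i, x i ∈ Set.Icc (0 : ℝ) 1) (y : ℝ) :
    esw y x ≤ (3 / 2) * esw (midOrNearest x) x := by
  have : Nonempty (Fin n) := ⟨⟨0, hn⟩⟩
  suffices h : (2 / 3) * esw y x ≤ esw (midOrNearest x) x by linarith
  refine le_ciInf fun k => ?_
  obtain ⟨i, hi⟩ := exists_eq_ciInf_of_finite (f := x)
  obtain ⟨j, hj⟩ := exists_eq_ciSup_of_finite (f := x)
  have hik : (⨅ i, x i) ≤ x k := ciInf_le (Set.finite_range x).bddBelow k
  have hkj : x k ≤ ⨆ i, x i := le_ciSup (Set.finite_range x).bddAbove k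
  have ui := esw_le_util y x i
  have uj := esw_le_util y x j
  obtain ⟨hi0, -⟩ := hx i
  obtain ⟨-, hj1⟩ := hx j
  unfold midOrNearest
  rw [← hi, ← hj] at *
  unfold util at *
  have i1 := le_abs_self (y - x i)
  have i2 := neg_le_abs (y - x i)
  have j1 := le_abs_self (y - x j)
  have j2 := neg_le_abs (y - x j)
  split_ifs with h1 h2
  · obtain ⟨h3, h4⟩ := h1
    rcases abs_cases (1 / 2 - x k) with ⟨h, -⟩ | ⟨h, -⟩ <;> rw [h] <;> linarith
  · rw [abs_of_nonneg (by linarith)]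
    linarith
  · have h3 : 1 / 2 < x i := by
      by_contra h
      exact h1 ⟨not_lt.mp h, not_lt.mp h2⟩
    rw [abs_of_nonpos (by linarith)]
    linarith

/-- If a misreport moves the facility exactly to the agent's location, then a strategy-proof
mechanism already places it there. -/
theorem strategyProof.eq_of_update_eq {n : ℕ} {f : (Fin n → ℝ) → ℝ} (hf : strategyProof f)
    {x : Fin n → ℝ} (hx : inProfile x) (i : Fin n) {z : ℝ} (hz : z ∈ Set.Icc (0 : ℝ) 1)
    (h : f (Function.update x i z) = x i) : f x = x i := by
  have key := hf x hx i z hz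
  rw [h] at key
  simp only [util, sub_self, abs_zero] at key
  have := abs_nonneg (f x - x i)
  exact sub_eq_zero.mp (abs_eq_zero.mp (by linarith))

theorem inProfile_pair {a b : ℝ} (ha : a ∈ Set.Icc (0 : ℝ) 1) (hb : b ∈ Set.Icc (0 : ℝ) 1) :
    inProfile ![a, b] := by
  intro i
  fin_cases i
  · exact ha
  · exact hb

/-- If two agents are at distance at least `1 / 2`, a facility on one of them is worse than the
midpoint by a factor of at least `3 / 2`. -/
theorem mul_esw_endpoint_lt {a b p ρ : ℝ} (hab : 1 / 2 ≤ b - a) (hab1 : b - a ≤ 1)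
    (hp : p = a ∨ p = b) (hρ : ρ < 3 / 2) :
    ρ * esw p ![a, b] < esw ((a + b) / 2) ![a, b] := by
  have h1 : esw p ![a, b] = 1 - (b - a) := by
    rw [esw_pair]
    unfold util
    rcases hp with rfl | rfl
    · rw [sub_self, abs_zero, abs_of_nonpos (by linarith), min_eq_right (by linarith)]
      ring
    · rw [sub_self, abs_zero, abs_of_nonneg (by linarith), min_eq_left (by linarith)]
  have h2 : esw ((a + b) / 2) ![a, b] = 1 - (b - a) / 2 := by
    rw [esw_pair]
    unfold util
    rw [abs_of_nonneg (by linarith), abs_of_nonpos (by linarith), min_eq_left (by linarith)]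
    ring
  rw [h1, h2]
  rcases hab1.lt_or_eq with h | h
  · nlinarith [mul_pos (sub_pos.mpr hρ) (sub_pos.mpr h)]
  · rw [h]
    norm_num

theorem exists_mul_esw_lt (f : (Fin 2 → ℝ) → ℝ)
    (hf : ∀ x, inProfile x → f x ∈ Set.Icc (0 : ℝ) 1) (hsp : strategyProof f)
    {ρ : ℝ} (hρ : ρ < 3 / 2) :
    ∃ x : Fin 2 → ℝ, inProfile x ∧ ∃ y ∈ Set.Icc (0 : ℝ) 1, esw y x > ρ * esw (f x) x := by
  have m0 : (0 : ℝ) ∈ Set.Icc (0 : ℝ) 1 := by simp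
  have m1 : (1 : ℝ) ∈ Set.Icc (0 : ℝ) 1 := by simp
  have mp := hf ![0, 1] (inProfile_pair m0 m1)
  obtain ⟨p, hp⟩ : ∃ p, p = f ![0, 1] := ⟨_, rfl⟩
  rw [← hp] at mp
  have ⟨p0, p1⟩ := mp
  rcases le_total (1 / 2) p with h | h
  · have hx := inProfile_pair m0 mp
    have e : f ![0, p] = p := hsp.eq_of_update_eq hx 1 m1 (by
      have : Function.update ![0, p] 1 1 = ![0, 1] := by
        ext i; fin_cases i <;> simp
      rw [this, ← hp]
      rfl)
    refine ⟨_, hx, (0 + p) / 2, ⟨by linarith, by linarith⟩, ?_⟩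
    rw [e]
    exact mul_esw_endpoint_lt (by linarith) (by linarith) (Or.inr rfl) hρ
  · have hx := inProfile_pair mp m1
    have e : f ![p, 1] = p := hsp.eq_of_update_eq hx 0 m0 (by
      have : Function.update ![p, 1] 0 0 = ![0, 1] := by
        ext i; fin_cases i <;> simp
      rw [this, ← hp]
      rfl)
    refine ⟨_, hx, (p + 1) / 2, ⟨by linarith, by linarith⟩, ?_⟩
    rw [e]
    exact mul_esw_endpoint_lt (by linarith) (by linarith) (Or.inl rfl) hρ

theorem midOrNearest_esw_approx :
    (∀ n : ℕ, 0 < n → ∀ x : Fin n → ℝ, (∀ i, x i ∈ Set.Icc (0 : ℝ) 1) →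
      ∀ y ∈ Set.Icc (0 : ℝ) 1, esw y x ≤ (3 / 2) * esw (midOrNearest x) x) ∧
    (∀ f : (Fin 2 → ℝ) → ℝ, (∀ x, inProfile x → f x ∈ Set.Icc (0 : ℝ) 1) →
      strategyProof f → ∀ ρ : ℝ, ρ < 3 / 2 →
      ∃ x : Fin 2 → ℝ, inProfile x ∧
        ∃ y ∈ Set.Icc (0 : ℝ) 1, esw y x > ρ * esw (f x) x) := by
  exact ⟨fun n hn x hx y _ => esw_le_esw_midOrNearest hn x hx y,
    fun f hf hsp _ hρ => exists_mul_esw_lt f hf hsp hρ⟩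
end
end
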